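/- Let A be a four-dimensional power-commutative real division algebra and e ∈ A an exceptional idempotent. Then for every element x ∈ A \ C(e) that is not a scalar multiple of an idempotent, the one-dimensional subspace A(x) ∩ C(e) (where A(x) is the subalgebra generated by x) contains a unique nonzero idempotent, and this idempotent is exceptional. -/

import Mathlib

open Module

section Defs

variable {A : Type*} [AddCommGroup A] [Module ℝ A]

/-- A linear subspace closed under the multiplication `m`. -/
def IsSubalg (m : A →ₗ[ℝ] A →ₗ[ℝ] A) (U : Submodule ℝ A) : Prop :=
  ∀ x ∈ U, ∀ y ∈ U, m x y ∈ U

/-- The subalgebra generated by a set `s`: the smallest subspace containing `s`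
and closed under multiplication. -/
def genSubalg (m : A →ₗ[ℝ] A →ₗ[ℝ] A) (s : Set A) : Submodule ℝ A :=
  sInf {U : Submodule ℝ A | IsSubalg m U ∧ s ⊆ (U : Set A)}

/-- `m` is a division-algebra multiplication: for nonzero `a`, both left and
right multiplication by `a` are bijective. -/
def IsDivision (m : A →ₗ[ℝ] A →ₗ[ℝ] A) : Prop :=
  ∀ a : A, a ≠ 0 →
    Function.Bijective (fun x : A => m a x) ∧ Function.Bijective (fun x : A => m x a)

/-- Power-commutativity: every subalgebra generated by a single element is commutative. -/
def PowerComm (m : A →ₗ[ℝ] A →ₗ[ℝ] A) : Prop :=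
  ∀ x : A, ∀ a ∈ genSubalg m {x}, ∀ b ∈ genSubalg m {x}, m a b = m b a

/-- An omnipresent idempotent: a nonzero idempotent contained in every
two-dimensional subalgebra. -/
def Omnipresent (m : A →ₗ[ℝ] A →ₗ[ℝ] A) (e : A) : Prop :=
  e ≠ 0 ∧ m e e = e ∧
    ∀ U : Submodule ℝ A, IsSubalg m U → Module.finrank ℝ U = 2 → e ∈ U

/-- `one` is an identity element for `m` and for every `x` the elements
`one, x, x²` are linearly dependent. -/
def IsQuadraticWith (m : A →ₗ[ℝ] A →ₗ[ℝ] A) (one : A) : Prop :=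
  (∀ x : A, m one x = x ∧ m x one = x) ∧
    ∀ x : A, ¬ LinearIndependent ℝ ![one, x, m x x]

/-- A quadratic algebra: unital, and `1, x, x²` linearly dependent for all `x`. -/
def IsQuadratic (m : A →ₗ[ℝ] A →ₗ[ℝ] A) : Prop :=
  ∃ one : A, IsQuadraticWith m one

/-- The isotope multiplication `x ∘ y = (T x)·(T y)`. -/
def isotope (m : A →ₗ[ℝ] A →ₗ[ℝ] A) (T : A →ₗ[ℝ] A) : A →ₗ[ℝ] A →ₗ[ℝ] A :=
  (m.compl₂ T).comp T

/-- A planar map on a quadratic division algebra with identity `one`: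
invertible, fixes `one`, and leaves every subalgebra invariant. -/
def Planar (m : A →ₗ[ℝ] A →ₗ[ℝ] A) (one : A) (T : A →ₗ[ℝ] A) : Prop :=
  Function.Bijective T ∧ T one = one ∧
    ∀ U : Submodule ℝ A, IsSubalg m U → ∀ x ∈ U, T x ∈ U

/-- The imaginary space `Im B = {x ∉ ℝ·1 : x² ∈ ℝ·1} ∪ {0}` of a quadratic algebra. -/
def ImSet (m : A →ₗ[ℝ] A →ₗ[ℝ] A) (one : A) : Set A :=
  {x : A | x ∉ Submodule.span ℝ {one} ∧ m x x ∈ Submodule.span ℝ {one}} ∪ {0}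

/-- The centraliser `C(e) = {y : e·y = y·e}`, a linear subspace. -/
def centraliser (m : A →ₗ[ℝ] A →ₗ[ℝ] A) (e : A) : Submodule ℝ A :=
  LinearMap.ker (m e - m.flip e)

/-- An exceptional idempotent of a four-dimensional algebra: its centraliser is
three-dimensional and closed under squaring. -/
def Exceptional (m : A →ₗ[ℝ] A →ₗ[ℝ] A) (e : A) : Prop :=
  Module.finrank ℝ (centraliser m e) = 3 ∧
    ∀ x ∈ centraliser m e, m x x ∈ centraliser m e

end Defs

section LinearAlgebra

variable {V : Type*} [AddCommGroup V] [Module ℝ V]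

/-- A subspace of codimension at most one together with a vector outside of it spans. -/
lemma exists_eq_add_smul_of_finrank_le [FiniteDimensional ℝ V] {U W : Submodule ℝ V}
    (hUW : U ≤ W) {w : V} (hw : w ∈ W) (hwU : w ∉ U) (hfin : finrank ℝ W ≤ finrank ℝ U + 1)
    {v : V} (hv : v ∈ W) : ∃ u ∈ U, ∃ c : ℝ, v = u + c • w := by
  have hle : U ⊔ Submodule.span ℝ {w} ≤ W :=
    sup_le hUW ((Submodule.span_singleton_le_iff_mem w W).2 hw)
  have hlt : U < U ⊔ Submodule.span ℝ {w} :=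
    lt_of_le_of_ne le_sup_left fun h => hwU <| by
      rw [h]
      exact Submodule.mem_sup_right (Submodule.mem_span_singleton_self w)
  have heq := Submodule.eq_of_le_of_finrank_le hle
    (hfin.trans (Submodule.finrank_lt_finrank_of_lt hlt))
  rw [← heq, Submodule.mem_sup] at hv
  obtain ⟨u, hu, z, hz, rfl⟩ := hv
  obtain ⟨c, rfl⟩ := Submodule.mem_span_singleton.1 hz
  exact ⟨u, hu, c, rfl⟩

lemma finrank_span_pair_of_notMem {v w : V} (hv : v ≠ 0) (hw : w ∉ Submodule.span ℝ {v}) :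
    finrank ℝ (Submodule.span ℝ {v, w}) = 2 := by
  have h : LinearIndependent ℝ ![v, w] :=
    (LinearIndependent.pair_iff' hv).2 fun a ha => hw (Submodule.mem_span_singleton.2 ⟨a, ha⟩)
  rw [← Matrix.range_cons_cons_empty v w ![], finrank_span_eq_card h, Fintype.card_fin]

/-- A linear functional separating a nonzero vector from another vector outside its span. -/
lemma exists_dual_eq_one_eq_zero {v w : V} (hw : w ∉ Submodule.span ℝ {v}) :
    ∃ φ : V →ₗ[ℝ] ℝ, φ w = 1 ∧ φ v = 0 := by
  obtain ⟨φ, h, hφ⟩ := Submodule.exists_le_ker_of_notMem hw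
  refine ⟨(φ w)⁻¹ • φ, by simp [h], ?_⟩
  have : φ v = 0 := hφ (Submodule.mem_span_singleton_self v)
  simp [this]

lemma notMem_span_singleton_symm {v w : V} (hv : v ≠ 0) (h : w ∉ Submodule.span ℝ {v}) :
    v ∉ Submodule.span ℝ {w} := by
  intro hv'
  obtain ⟨c, rfl⟩ := Submodule.mem_span_singleton.1 hv'
  have hc : c ≠ 0 := by
    rintro rfl
    simp at hv
  exact h (Submodule.mem_span_singleton.2 ⟨c⁻¹, by simp [smul_smul, hc]⟩)

/-- A linear pencil spanned by two endomorphisms of an odd-dimensional space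
contains a nontrivial singular member. -/
lemma exists_singular_combination_of_odd [FiniteDimensional ℝ V] (hV : Odd (finrank ℝ V))
    (S T : V →ₗ[ℝ] V) :
    ∃ a b : ℝ, (a ≠ 0 ∨ b ≠ 0) ∧ ∃ v : V, v ≠ 0 ∧ (a • S + b • T) v = 0 := by
  let B := finBasis ℝ V
  let d : ℝ → ℝ := fun t => (Real.cos t • S + Real.sin t • T).det
  have hcont : Continuous d := by
    have : d = fun t => (Real.cos t • LinearMap.toMatrix B B S +
        Real.sin t • LinearMap.toMatrix B B T).det := by
      funext t
      simp [d, ← LinearMap.det_toMatrix B]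
    rw [this]
    exact Continuous.matrix_det (by fun_prop)
  have h0 : d 0 = S.det := by simp [d]
  have hpi : d Real.pi = - S.det := by
    have : d Real.pi = ((-1 : ℝ) • S).det := by simp [d]
    rw [this, LinearMap.det_smul, hV.neg_one_pow, neg_one_mul]
  have hzero : (0 : ℝ) ∈ Set.uIcc (d 0) (d Real.pi) := by
    rw [h0, hpi, Set.mem_uIcc]
    rcases le_total 0 S.det with h | h
    · exact Or.inr ⟨by linarith, h⟩
    · exact Or.inl ⟨h, by linarith⟩
  obtain ⟨t, -, ht⟩ := intermediate_value_uIcc hcont.continuousOn hzero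
  obtain ⟨v, hv, hv0⟩ := Submodule.exists_mem_ne_zero_of_ne_bot
    (LinearMap.bot_lt_ker_of_det_eq_zero ht).ne'
  refine ⟨Real.cos t, Real.sin t, ?_, v, hv0, hv⟩
  by_contra! h
  have := Real.sin_sq_add_cos_sq t
  simp [h.1, h.2] at this

end LinearAlgebra

section DivisionAlgebra

variable {A : Type*} [AddCommGroup A] [Module ℝ A] {m : A →ₗ[ℝ] A →ₗ[ℝ] A}

lemma mem_centraliser {e y : A} : y ∈ centraliser m e ↔ m e y = m y e := by
  simp [centraliser, sub_eq_zero]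

lemma self_mem_centraliser (e : A) : e ∈ centraliser m e := mem_centraliser.2 rfl

lemma mem_centraliser_comm {e y : A} : y ∈ centraliser m e ↔ e ∈ centraliser m y := by
  rw [mem_centraliser, mem_centraliser, eq_comm]

lemma self_mem_genSubalg (x : A) : x ∈ genSubalg m {x} :=
  Submodule.mem_sInf.2 fun _ hU => hU.2 rfl

lemma isSubalg_genSubalg (s : Set A) : IsSubalg m (genSubalg m s) := by
  intro x hx y hy
  refine Submodule.mem_sInf.2 fun U hU => ?_
  exact hU.1 x (Submodule.mem_sInf.1 hx U hU) y (Submodule.mem_sInf.1 hy U hU)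

lemma genSubalg_le {s : Set A} {U : Submodule ℝ A} (hU : IsSubalg m U) (hs : s ⊆ U) :
    genSubalg m s ≤ U := sInf_le ⟨hU, hs⟩

namespace IsDivision

lemma eq_zero_or_eq_zero (hdiv : IsDivision m) {a b : A} (h : m a b = 0) : a = 0 ∨ b = 0 := by
  by_contra! hab
  exact hab.2 ((hdiv a hab.1).1.injective (by simpa using h))

/-- A nonzero element whose square is proportional to it spans a line with an idempotent. -/
lemma exists_idempotent_smul (hdiv : IsDivision m) {d : A} (hd : d ≠ 0)
    (h : m d d ∈ Submodule.span ℝ {d}) :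
    ∃ c : ℝ, c ≠ 0 ∧ m (c • d) (c • d) = c • d := by
  obtain ⟨c, hc⟩ := Submodule.mem_span_singleton.1 h
  have hc0 : c ≠ 0 := by
    rintro rfl
    rw [zero_smul] at hc
    exact hd ((hdiv.eq_zero_or_eq_zero hc.symm).elim id id)
  refine ⟨c⁻¹, inv_ne_zero hc0, ?_⟩
  simp [← hc, smul_smul, hc0]

lemma finrank_subalg_ne_three [FiniteDimensional ℝ A] (hdiv : IsDivision m)
    {U : Submodule ℝ A} (hU : IsSubalg m U) : finrank ℝ U ≠ 3 := by
  intro h3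
  obtain ⟨a, ha⟩ : ∃ a : U, a ≠ 0 := by
    have : Nontrivial U := nontrivial_of_finrank_pos (R := ℝ) (by omega)
    exact exists_ne 0
  obtain ⟨b, hb⟩ : ∃ b : U, b ∉ Submodule.span ℝ {a} := by
    by_contra! h
    have h1 := finrank_span_singleton (K := ℝ) ha
    rw [(Submodule.eq_top_iff'.2 h : Submodule.span ℝ {a} = ⊤), finrank_top] at h1
    omega
  obtain ⟨s, t, hst, v, hv, hv0⟩ := exists_singular_combination_of_odd
    (V := U) (by rw [h3]; decide) ((m a).restrict fun y hy => hU a a.2 y hy)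
    ((m b).restrict fun y hy => hU b b.2 y hy)
  have hmul : m (s • (a : A) + t • (b : A)) v = 0 := by
    have := congrArg (Subtype.val) hv0
    simpa using this
  rcases hdiv.eq_zero_or_eq_zero hmul with h | h
  · have h' : s • a + t • b = 0 := Subtype.ext (by simpa using h)
    have hlin := (LinearIndependent.pair_iff' (K := ℝ) ha).2
      fun c hc => hb (Submodule.mem_span_singleton.2 ⟨c, hc⟩)
    have := LinearIndependent.pair_iff.1 hlin s t h'
    tauto
  · exact hv (Subtype.ext h)

end IsDivision

/-- Subalgebras generated by a single element have dimension at most two, provided the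
four-dimensional power-commutative division algebra is not commutative. -/
lemma finrank_genSubalg_le_two [FiniteDimensional ℝ A] (hdim : finrank ℝ A = 4)
    (hdiv : IsDivision m) (hpc : PowerComm m) {e : A} (he : finrank ℝ (centraliser m e) = 3)
    (x : A) : finrank ℝ (genSubalg m {x}) ≤ 2 := by
  have h3 := hdiv.finrank_subalg_ne_three (isSubalg_genSubalg (m := m) {x})
  have hle := Submodule.finrank_le (genSubalg m {x})
  suffices finrank ℝ (genSubalg m {x}) ≠ 4 by omega
  intro h4
  have htop : genSubalg m {x} = ⊤ := Submodule.eq_top_of_finrank_eq (by omega)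
  have : centraliser m e = ⊤ := Submodule.eq_top_iff'.2 fun y =>
    mem_centraliser.2 (hpc x e (htop ▸ trivial) y (htop ▸ trivial))
  rw [this, finrank_top] at he
  omega

lemma finrank_genSubalg_inf_le_one [FiniteDimensional ℝ A] (hdim : finrank ℝ A = 4)
    (hdiv : IsDivision m) (hpc : PowerComm m) {e : A} (he : finrank ℝ (centraliser m e) = 3)
    {x : A} (hx : x ∉ centraliser m e) :
    finrank ℝ (genSubalg m {x} ⊓ centraliser m e : Submodule ℝ A) ≤ 1 := by
  have hlt : genSubalg m {x} ⊓ centraliser m e < genSubalg m {x} :=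
    inf_lt_left.2 fun h => hx (h (self_mem_genSubalg x))
  have := Submodule.finrank_lt_finrank_of_lt hlt
  have := finrank_genSubalg_le_two hdim hdiv hpc he x
  omega

lemma genSubalg_inf_centraliser_le_span [FiniteDimensional ℝ A] (hdim : finrank ℝ A = 4)
    (hdiv : IsDivision m) (hpc : PowerComm m) {e : A} (he : finrank ℝ (centraliser m e) = 3)
    {x : A} (hx : x ∉ centraliser m e) {z : A} (hz : z ≠ 0)
    (hzmem : z ∈ genSubalg m {x} ⊓ centraliser m e) :
    genSubalg m {x} ⊓ centraliser m e ≤ Submodule.span ℝ {z} := by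
  have hle := (Submodule.span_singleton_le_iff_mem z _).2 hzmem
  refine (Submodule.eq_of_le_of_finrank_le hle ?_).ge
  rw [finrank_span_singleton hz]
  exact finrank_genSubalg_inf_le_one hdim hdiv hpc he hx

/-- Only `e` commutes with everything in `C(e)`, up to scalars, when `C(e)` is
three-dimensional and closed under squaring. -/
lemma not_centraliser_le_of_exceptional [FiniteDimensional ℝ A] (hdiv : IsDivision m) {e f : A}
    (he : e ≠ 0) (hexc : Exceptional m e) (hf : f ∈ centraliser m e)
    (hfe : f ∉ Submodule.span ℝ {e}) : ¬ centraliser m e ≤ centraliser m f := by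
  intro hcent
  have hspan : Submodule.span ℝ {e, f} ≤ centraliser m e := by
    rw [Submodule.span_le]
    rintro y (rfl | rfl)
    exacts [self_mem_centraliser _, hf]
  have hcomm_span : ∀ c ∈ Submodule.span ℝ {e, f}, centraliser m e ≤ centraliser m c := by
    intro c hc y hy
    obtain ⟨a, b, rfl⟩ := Submodule.mem_span_pair.1 hc
    have h1 := mem_centraliser.1 hy
    have h2 := mem_centraliser.1 (hcent hy)
    simp [mem_centraliser, h1, h2]
  have hcomm : ∀ c ∈ centraliser m e, centraliser m e ≤ centraliser m c := by
    intro c hc y hy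
    by_cases hcs : c ∈ Submodule.span ℝ {e, f}
    · exact hcomm_span c hcs hy
    · obtain ⟨u, hu, s, rfl⟩ := exists_eq_add_smul_of_finrank_le hspan hc hcs
        (by rw [finrank_span_pair_of_notMem he hfe, hexc.1]) hy
      have := mem_centraliser.2 (mem_centraliser.1 (hcomm_span u hu hc)).symm
      exact add_mem this (Submodule.smul_mem _ _ (self_mem_centraliser c))
  refine hdiv.finrank_subalg_ne_three (U := centraliser m e) (fun a ha b hb => ?_) hexc.1
  have hab := hexc.2 _ (add_mem ha hb)
  have hsum : m (a + b) (a + b) = m a a + m b b + (2 : ℝ) • m a b := by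
    have := mem_centraliser.1 (hcomm a ha hb)
    simp only [map_add, LinearMap.add_apply, ← this]
    module
  rw [hsum] at hab
  have h2 := (Submodule.add_mem_iff_right _
    (add_mem (hexc.2 a ha) (hexc.2 b hb))).1 hab
  exact (Submodule.smul_mem_iff _ two_ne_zero).1 h2

/-- Two independent idempotents span a plane in which the elements proportional to their
squares lie on at most three lines. -/
lemma exists_mul_mul_eq_zero_of_sq_mem_span (hdiv : IsDivision m) {f g : A} (hff : m f f = f)
    (hgg : m g g = g) (hf : f ≠ 0) (hgf : g ∉ Submodule.span ℝ {f}) :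
    ∃ α β : ℝ, (α ≠ 0 ∨ β ≠ 0) ∧ ∀ a b : ℝ,
      m (a • f + b • g) (a • f + b • g) ∈ Submodule.span ℝ {a • f + b • g} →
        a * b * (α * a + β * b) = 0 := by
  have hsq : ∀ a b : ℝ, m (a • f + b • g) (a • f + b • g) =
      (a * a) • f + (b * b) • g + (a * b) • (m f g + m g f) := by
    intro a b
    simp only [map_add, map_smul, LinearMap.add_apply, LinearMap.smul_apply, hff, hgg]
    module
  have hlin := (LinearIndependent.pair_iff' (K := ℝ) hf).2
      fun c hc => hgf (Submodule.mem_span_singleton.2 ⟨c, hc⟩)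
  by_cases hw : m f g + m g f ∈ Submodule.span ℝ {f, g}
  · obtain ⟨u, v, huv⟩ := Submodule.mem_span_pair.1 hw
    refine ⟨1 - v, u - 1, ?_, fun a b h => ?_⟩
    · by_contra! hcon
      have hv : v = 1 := by linarith [hcon.1]
      have hu : u = 1 := by linarith [hcon.2]
      have h0 : m (f - g) (f - g) = 0 := by
        have : m (f - g) (f - g) = f + g - (m f g + m g f) := by
          simp only [map_sub, LinearMap.sub_apply, hff, hgg]
          module
        rw [this, ← huv, hu, hv]
        module
      have hfg : f - g = 0 := (hdiv.eq_zero_or_eq_zero h0).elim id id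
      exact hgf (sub_eq_zero.1 hfg ▸ Submodule.mem_span_singleton_self f)
    · obtain ⟨c, hc⟩ := Submodule.mem_span_singleton.1 h
      rw [hsq, ← huv] at hc
      obtain ⟨h1, h2⟩ := LinearIndependent.pair_iff.1 hlin
        (c * a - a * a - a * b * u) (c * b - b * b - a * b * v) (by
          rw [← sub_eq_zero] at hc
          rw [← hc]
          module)
      linear_combination a * h2 - b * h1
  · refine ⟨1, 0, Or.inl one_ne_zero, fun a b h => ?_⟩
    obtain ⟨c, hc⟩ := Submodule.mem_span_singleton.1 h
    suffices a * b = 0 by simp [this]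
    by_contra hab
    refine hw ((Submodule.smul_mem_iff _ hab).1 (Submodule.mem_span_pair.2
      ⟨c * a - a * a, c * b - b * b, ?_⟩))
    rw [hsq] at hc
    rw [← sub_eq_zero] at hc ⊢
    rw [← hc]
    module

/-- When the linear functional `h` has kernel `C(e)`, this element of `A(x)` lies in `C(e)`. -/
def centralPart (m : A →ₗ[ℝ] A →ₗ[ℝ] A) (h : A →ₗ[ℝ] ℝ) (x : A) : A :=
  h x • m x x - h (m x x) • x

lemma centralPart_mem {e : A} {h : A →ₗ[ℝ] ℝ} (hh : LinearMap.ker h = centraliser m e) (x : A) :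
    centralPart m h x ∈ genSubalg m {x} ⊓ centraliser m e := by
  have hx := self_mem_genSubalg (m := m) x
  refine ⟨sub_mem (Submodule.smul_mem _ _ (isSubalg_genSubalg _ x hx x hx))
    (Submodule.smul_mem _ _ hx), ?_⟩
  rw [← hh]
  simp [centralPart, mul_comm]

lemma mem_centraliser_of_mem_genSubalg (hpc : PowerComm m) {x a b : A}
    (ha : a ∈ genSubalg m {x}) (hb : b ∈ genSubalg m {x}) : b ∈ centraliser m a :=
  mem_centraliser.2 (hpc x a ha b hb)

lemma sq_mem_span_of_mem_genSubalg_inf [FiniteDimensional ℝ A] (hdim : finrank ℝ A = 4)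
    (hdiv : IsDivision m) (hpc : PowerComm m) {e : A} (hexc : Exceptional m e)
    {x : A} (hx : x ∉ centraliser m e) {d : A} (hd : d ∈ genSubalg m {x} ⊓ centraliser m e) :
    m d d ∈ Submodule.span ℝ {d} := by
  rcases eq_or_ne d 0 with rfl | hd0
  · simp
  · exact genSubalg_inf_centraliser_le_span hdim hdiv hpc hexc.1 hx hd0 hd
      ⟨isSubalg_genSubalg _ d hd.1 d hd.1, hexc.2 d hd.2⟩

/-- The main step: the idempotent in `A(x) ∩ C(e)` does not move when `x` is translated
along `e`. -/
lemma exists_centralPart_add_smul_mem_span [FiniteDimensional ℝ A] (hdim : finrank ℝ A = 4)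
    (hdiv : IsDivision m) (hpc : PowerComm m) {e : A} (hexc : Exceptional m e)
    {h : A →ₗ[ℝ] ℝ} (hh : LinearMap.ker h = centraliser m e)
    {x : A} (hx : x ∉ centraliser m e) {f : A} (hf : f ≠ 0) (hff : m f f = f)
    {κ : ℝ} (hκ : κ ≠ 0) (hP : centralPart m h x = κ • f) :
    ∃ t : ℝ, t ≠ 0 ∧ centralPart m h (x + t • e) ∈ Submodule.span ℝ {f} := by
  have hee := self_mem_centraliser (m := m) e
  have hxt : ∀ t : ℝ, x + t • e ∉ centraliser m e := fun t ht =>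
    hx ((Submodule.add_mem_iff_left _ (Submodule.smul_mem _ t hee)).1 ht)
  have hD : ∀ t : ℝ, centralPart m h (x + t • e) ∈ centraliser m e ⊓ centraliser m x := by
    intro t
    obtain ⟨h1, h2⟩ := centralPart_mem hh (x + t • e)
    refine ⟨h2, mem_centraliser_comm.2 ?_⟩
    have := mem_centraliser_of_mem_genSubalg hpc h1 (self_mem_genSubalg (x + t • e))
    exact (Submodule.add_mem_iff_left _
      (Submodule.smul_mem _ t (mem_centraliser_comm.1 h2))).1 this
  have hDfin : finrank ℝ (centraliser m e ⊓ centraliser m x : Submodule ℝ A) ≤ 2 := by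
    have hlt : centraliser m e ⊓ centraliser m x < centraliser m e :=
      inf_lt_left.2 fun hle => hx (mem_centraliser_comm.1 (hle hee))
    have := Submodule.finrank_lt_finrank_of_lt hlt
    have := hexc.1
    omega
  by_contra! hcon
  have hd := hcon 1 one_ne_zero
  set d := centralPart m h (x + (1 : ℝ) • e)
  have hd0 : d ≠ 0 := fun h0 => hd (h0 ▸ zero_mem _)
  obtain ⟨c, hc, hcd⟩ := hdiv.exists_idempotent_smul hd0
    (sq_mem_span_of_mem_genSubalg_inf hdim hdiv hpc hexc (hxt 1) (centralPart_mem hh _))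
  have hgf : c • d ∉ Submodule.span ℝ {f} := fun hmem =>
    hd ((Submodule.smul_mem_iff _ hc).1 hmem)
  have hgD : c • d ∈ centraliser m e ⊓ centraliser m x := Submodule.smul_mem _ _ (hD 1)
  clear_value d
  generalize c • d = g at *
  have hfD : f ∈ centraliser m e ⊓ centraliser m x := by
    have := hD 0
    rw [zero_smul, add_zero, hP] at this
    exact (Submodule.smul_mem_iff _ hκ).1 this
  have hDspan : centraliser m e ⊓ centraliser m x ≤ Submodule.span ℝ {f, g} := by
    refine (Submodule.eq_of_le_of_finrank_le ?_ ?_).ge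
    · rw [Submodule.span_le]
      rintro y (rfl | rfl)
      exacts [hfD, hgD]
    · rwa [finrank_span_pair_of_notMem hf hgf]
  obtain ⟨φ, hφf, hφg⟩ := exists_dual_eq_one_eq_zero (notMem_span_singleton_symm hf hgf)
  obtain ⟨ψ, hψg, hψf⟩ := exists_dual_eq_one_eq_zero hgf
  set a : ℝ → ℝ := fun t => φ (centralPart m h (x + t • e)) with ha_def
  set b : ℝ → ℝ := fun t => ψ (centralPart m h (x + t • e)) with hb_def
  have hab : ∀ t, centralPart m h (x + t • e) = a t • f + b t • g := by
    intro t
    obtain ⟨p, q, hpq⟩ := Submodule.mem_span_pair.1 (hDspan (hD t))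
    simp [ha_def, hb_def, ← hpq, hφf, hφg, hψf, hψg]
  have ha : Continuous a := by
    simp only [ha_def, centralPart, map_add, map_smul, map_sub, LinearMap.add_apply,
      LinearMap.smul_apply, smul_eq_mul]
    fun_prop
  have hb : Continuous b := by
    simp only [hb_def, centralPart, map_add, map_smul, map_sub, LinearMap.add_apply,
      LinearMap.smul_apply, smul_eq_mul]
    fun_prop
  have ha0 : a 0 = κ := by simp [ha_def, hP, hφf]
  have hb0 : b 0 = 0 := by simp [hb_def, hP, hψf]
  obtain ⟨α, β, hαβ, hcubic⟩ := exists_mul_mul_eq_zero_of_sq_mem_span hdiv hff hcd hf hgf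
  have hab0 : ∀ t, a t * b t * (α * a t + β * b t) = 0 := by
    intro t
    apply hcubic
    rw [← hab]
    exact sq_mem_span_of_mem_genSubalg_inf hdim hdiv hpc hexc (hxt t) (centralPart_mem hh _)
  have hb_ne : ∀ t, t ≠ 0 → b t ≠ 0 := by
    intro t ht hbt
    apply hcon t ht
    rw [hab, hbt, zero_smul, add_zero]
    exact Submodule.smul_mem _ _ (Submodule.mem_span_singleton_self f)
  have hα : α = 0 := by
    by_contra hα
    have hcont : Continuous fun t => a t * (α * a t + β * b t) := by fun_prop
    have hev := hcont.continuousAt.eventually_ne (x := 0) (y := 0) (by simp [ha0, hb0, hκ, hα])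
    obtain ⟨t, ht, ht0⟩ := ((hev.filter_mono nhdsWithin_le_nhds).and
      (self_mem_nhdsWithin (s := {0}ᶜ))).exists
    exact mul_ne_zero ht (hb_ne t ht0) (by linear_combination hab0 t)
  have hβ : β ≠ 0 := by tauto
  have hev := ha.continuousAt.eventually_ne (x := 0) (y := 0) (by simp [ha0, hκ])
  obtain ⟨t, ht, ht0⟩ := ((hev.filter_mono nhdsWithin_le_nhds).and
    (self_mem_nhdsWithin (s := {0}ᶜ))).exists
  have hbt := hb_ne t ht0
  refine mul_ne_zero (mul_ne_zero ht hbt) (mul_ne_zero hβ hbt) ?_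
  have := hab0 t
  rwa [hα, zero_mul, zero_add] at this

lemma mul_add_mul_mem_centraliser [FiniteDimensional ℝ A] (hdim : finrank ℝ A = 4)
    (hdiv : IsDivision m) (hpc : PowerComm m) {e : A} (hee : m e e = e) (hexc : Exceptional m e)
    {h : A →ₗ[ℝ] ℝ} (hh : LinearMap.ker h = centraliser m e)
    {x : A} (hx : x ∉ centraliser m e) {f : A} (hf : f ≠ 0) (hff : m f f = f)
    {κ : ℝ} (hκ : κ ≠ 0) (hP : centralPart m h x = κ • f) :
    m e x + m x e ∈ centraliser m f := by
  obtain ⟨t, ht, hmem⟩ :=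
    exists_centralPart_add_smul_mem_span hdim hdiv hpc hexc hh hx hf hff hκ hP
  have hfmem : f ∈ genSubalg m {x} ⊓ centraliser m e := by
    have := centralPart_mem hh x
    rw [hP] at this
    exact (Submodule.smul_mem_iff _ hκ).1 this
  have hxx := self_mem_genSubalg (m := m) x
  have hx1 : x ∈ centraliser m f := mem_centraliser_of_mem_genSubalg hpc hfmem.1 hxx
  have hx2 : m x x ∈ centraliser m f :=
    mem_centraliser_of_mem_genSubalg hpc hfmem.1 (isSubalg_genSubalg _ x hxx x hxx)
  have he : e ∈ centraliser m f := mem_centraliser_comm.1 hfmem.2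
  have hhx : h x ≠ 0 := fun h0 => hx (hh ▸ h0)
  have hhe : h e = 0 := by
    rw [← LinearMap.mem_ker, hh]
    exact self_mem_centraliser e
  obtain ⟨c, hc⟩ := Submodule.mem_span_singleton.1 hmem
  have hkey : (h x * t) • (m e x + m x e) = c • f + h (m (x + t • e) (x + t • e)) • (x + t • e)
      - h x • m x x - (h x * t * t) • e := by
    rw [hc, centralPart]
    simp only [map_add, map_smul, LinearMap.add_apply, LinearMap.smul_apply, hee, hhe]
    module
  rw [← Submodule.smul_mem_iff _ (mul_ne_zero hhx ht), hkey]
  exact sub_mem (sub_mem (add_mem (Submodule.smul_mem _ _ (self_mem_centraliser f))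
    (Submodule.smul_mem _ _ (add_mem hx1 (Submodule.smul_mem _ _ he))))
    (Submodule.smul_mem _ _ hx2)) (Submodule.smul_mem _ _ he)

lemma mul_add_mul_idempotent_mem_centraliser [FiniteDimensional ℝ A] (hdim : finrank ℝ A = 4)
    (hdiv : IsDivision m) (hpc : PowerComm m) {e : A} (hee : m e e = e) (hexc : Exceptional m e)
    {h : A →ₗ[ℝ] ℝ} (hh : LinearMap.ker h = centraliser m e)
    {x : A} (hx : x ∉ centraliser m e) {f : A} (hf : f ≠ 0) (hff : m f f = f)
    {κ : ℝ} (hκ : κ ≠ 0) (hP : centralPart m h x = κ • f) :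
    m e f + m f e ∈ centraliser m f := by
  have hfmem : f ∈ genSubalg m {x} ⊓ centraliser m e := by
    have := centralPart_mem hh x
    rw [hP] at this
    exact (Submodule.smul_mem_iff _ hκ).1 this
  have hxt : ∀ s : ℝ, x + s • f ∉ centraliser m e := fun s hs =>
    hx ((Submodule.add_mem_iff_left _ (Submodule.smul_mem _ s hfmem.2)).1 hs)
  have hspan : ∀ s : ℝ, centralPart m h (x + s • f) ∈ Submodule.span ℝ {f} := by
    intro s
    obtain ⟨h1, h2⟩ := centralPart_mem hh (x + s • f)
    refine genSubalg_inf_centraliser_le_span hdim hdiv hpc hexc.1 hx hf hfmem ⟨?_, h2⟩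
    refine genSubalg_le (isSubalg_genSubalg _) (Set.singleton_subset_iff.2 ?_) h1
    exact add_mem (self_mem_genSubalg x) (Submodule.smul_mem _ _ hfmem.1)
  obtain ⟨φ, hφf, -⟩ := exists_dual_eq_one_eq_zero (v := (0 : A)) (w := f) (by simpa using hf)
  have hcont : Continuous fun s : ℝ => φ (centralPart m h (x + s • f)) := by
    simp only [centralPart, map_add, map_smul, map_sub, LinearMap.add_apply,
      LinearMap.smul_apply, smul_eq_mul]
    fun_prop
  have hev := hcont.continuousAt.eventually_ne (x := 0) (y := 0) (by simp [hP, hφf, hκ])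
  obtain ⟨s, hs, hs0⟩ := ((hev.filter_mono nhdsWithin_le_nhds).and
    (self_mem_nhdsWithin (s := {0}ᶜ))).exists
  obtain ⟨c, hc⟩ := Submodule.mem_span_singleton.1 (hspan s)
  have hc0 : c ≠ 0 := by
    rintro rfl
    exact hs (by simp [← hc])
  have h1 := mul_add_mul_mem_centraliser hdim hdiv hpc hee hexc hh hx hf hff hκ hP
  have h2 := mul_add_mul_mem_centraliser hdim hdiv hpc hee hexc hh (hxt s) hf hff hc0 hc.symm
  have hsum : m e (x + s • f) + m (x + s • f) e =
      (m e x + m x e) + s • (m e f + m f e) := by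
    simp only [map_add, map_smul, LinearMap.add_apply, LinearMap.smul_apply]
    module
  rw [hsum] at h2
  exact (Submodule.smul_mem_iff _ hs0).1 ((Submodule.add_mem_iff_right _ h1).1 h2)

/-- An idempotent proportional to the nonzero vector `centralPart m h x` is exceptional. -/
lemma exceptional_of_centralPart_eq_smul [FiniteDimensional ℝ A] (hdim : finrank ℝ A = 4)
    (hdiv : IsDivision m) (hpc : PowerComm m) {e : A} (he : e ≠ 0) (hee : m e e = e)
    (hexc : Exceptional m e)
    {h : A →ₗ[ℝ] ℝ} (hh : LinearMap.ker h = centraliser m e)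
    {x : A} (hx : x ∉ centraliser m e) {f : A} (hf : f ≠ 0) (hff : m f f = f)
    {κ : ℝ} (hκ : κ ≠ 0) (hP : centralPart m h x = κ • f) :
    Exceptional m f := by
  have hfmem : f ∈ genSubalg m {x} ⊓ centraliser m e := by
    have := centralPart_mem hh x
    rw [hP] at this
    exact (Submodule.smul_mem_iff _ hκ).1 this
  have hxx := self_mem_genSubalg (m := m) x
  have hxf : x ∈ centraliser m f := mem_centraliser_of_mem_genSubalg hpc hfmem.1 hxx
  have hef : e ∈ centraliser m f := mem_centraliser_comm.1 hfmem.2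
  have hfe : f ∉ Submodule.span ℝ {e} := by
    intro hmem
    obtain ⟨c, rfl⟩ := Submodule.mem_span_singleton.1 hmem
    have hc : c ≠ 0 := by
      rintro rfl
      simp at hf
    have := (Submodule.smul_mem_iff _ hc).1 (mem_centraliser_comm.1 hxf)
    exact hx (mem_centraliser_comm.1 this)
  have hspan : Submodule.span ℝ {e, f} ≤ centraliser m e := by
    rw [Submodule.span_le]
    rintro y (rfl | rfl)
    exacts [self_mem_centraliser _, hfmem.2]
  have hspan' : Submodule.span ℝ {e, f} ≤ centraliser m f := by
    rw [Submodule.span_le]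
    rintro y (rfl | rfl)
    exacts [hef, self_mem_centraliser _]
  have hpair := finrank_span_pair_of_notMem he hfe
  have hne : centraliser m f ≠ ⊤ := fun htop =>
    not_centraliser_le_of_exceptional hdiv he hexc hfmem.2 hfe (htop ▸ le_top)
  have hlt := Submodule.finrank_lt hne
  have hgt := Submodule.finrank_lt_finrank_of_lt (lt_of_le_of_ne hspan' fun heq =>
    hx (hspan (heq ▸ hxf)))
  have hfin : finrank ℝ (centraliser m f) = 3 := by omega
  refine ⟨hfin, fun y hy => ?_⟩
  obtain ⟨u, hu, c, rfl⟩ := exists_eq_add_smul_of_finrank_le hspan' hxf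
    (fun hmem => hx (hspan hmem)) (by omega) hy
  obtain ⟨a, b, rfl⟩ := Submodule.mem_span_pair.1 hu
  have hsq : m (a • e + b • f + c • x) (a • e + b • f + c • x) =
      (a * a) • e + (b * b) • f + (c * c) • m x x + (a * b) • (m e f + m f e) +
      (a * c) • (m e x + m x e) + (b * c) • (m f x + m x f) := by
    simp only [map_add, map_smul, LinearMap.add_apply, LinearMap.smul_apply, hee, hff]
    module
  have hmem : ∀ y ∈ genSubalg m {x}, y ∈ centraliser m f := fun y hy =>
    mem_centraliser_of_mem_genSubalg hpc hfmem.1 hy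
  have hsub := isSubalg_genSubalg (m := m) {x}
  rw [hsq]
  refine add_mem (add_mem (add_mem (add_mem (add_mem ?_ ?_) ?_) ?_) ?_) ?_ <;>
    refine Submodule.smul_mem _ _ ?_
  · exact hef
  · exact self_mem_centraliser f
  · exact hmem _ (hsub x hxx x hxx)
  · exact mul_add_mul_idempotent_mem_centraliser hdim hdiv hpc hee hexc hh hx hf hff hκ hP
  · exact mul_add_mul_mem_centraliser hdim hdiv hpc hee hexc hh hx hf hff hκ hP
  · exact hmem _ (add_mem (hsub f hfmem.1 x hxx) (hsub x hxx f hfmem.1))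

/-- A centraliser of codimension one is the kernel of a linear functional. -/
lemma exists_ker_eq_centraliser [FiniteDimensional ℝ A] (hdim : finrank ℝ A = 4) {e : A}
    (he : finrank ℝ (centraliser m e) = 3) {x : A} (hx : x ∉ centraliser m e) :
    ∃ h : A →ₗ[ℝ] ℝ, LinearMap.ker h = centraliser m e := by
  obtain ⟨h, hhx, hle⟩ := Submodule.exists_le_ker_of_notMem hx
  refine ⟨h, (Submodule.eq_of_le_of_finrank_le hle ?_).symm⟩
  have := Submodule.finrank_lt (s := LinearMap.ker h) fun htop => hhx (by
    rw [← LinearMap.mem_ker, htop]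
    trivial)
  omega

end DivisionAlgebra

/-- Let `e` be an exceptional idempotent of a four-dimensional
power-commutative real division algebra. For every `x ∉ C(e)` that is not a scalar
multiple of an idempotent, `A(x) ∩ C(e)` is one-dimensional, contains a unique
nonzero idempotent, and that idempotent is exceptional. -/
theorem stmt_18 {A : Type*} [AddCommGroup A] [Module ℝ A] [FiniteDimensional ℝ A]
    (m : A →ₗ[ℝ] A →ₗ[ℝ] A)
    (hdim : Module.finrank ℝ A = 4)
    (hdiv : IsDivision m) (hpc : PowerComm m)
    (e : A) (he : e ≠ 0) (hee : m e e = e) (hexc : Exceptional m e)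
    (x : A) (hx : x ∉ centraliser m e)
    (hxni : ¬ ∃ (c : ℝ) (g : A), m g g = g ∧ x = c • g) :
    Module.finrank ℝ ((genSubalg m {x} ⊓ centraliser m e : Submodule ℝ A)) = 1 ∧
    ∃ f : A, (f ∈ genSubalg m {x} ⊓ centraliser m e ∧ f ≠ 0 ∧ m f f = f) ∧
      Exceptional m f ∧
      ∀ g : A, (g ∈ genSubalg m {x} ⊓ centraliser m e ∧ g ≠ 0 ∧ m g g = g) → g = f := by
  obtain ⟨h, hh⟩ := exists_ker_eq_centraliser hdim hexc.1 hx
  have hmem := centralPart_mem hh x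
  have hd0 : centralPart m h x ≠ 0 := by
    intro h0
    have hhx : h x ≠ 0 := fun h0 => hx (hh ▸ h0)
    have hx0 : x ≠ 0 := by
      rintro rfl
      simp at hhx
    have hsq : m x x ∈ Submodule.span ℝ {x} := by
      refine (Submodule.smul_mem_iff _ hhx).1 ?_
      rw [sub_eq_zero.1 h0]
      exact Submodule.smul_mem _ _ (Submodule.mem_span_singleton_self x)
    obtain ⟨c, hc, hcx⟩ := hdiv.exists_idempotent_smul hx0 hsq
    exact hxni ⟨c⁻¹, c • x, hcx, by simp [smul_smul, hc]⟩
  obtain ⟨c, hc, hff⟩ := hdiv.exists_idempotent_smul hd0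
    (sq_mem_span_of_mem_genSubalg_inf hdim hdiv hpc hexc hx hmem)
  have hf0 : c • centralPart m h x ≠ 0 := smul_ne_zero hc hd0
  have hfmem : c • centralPart m h x ∈ genSubalg m {x} ⊓ centraliser m e :=
    Submodule.smul_mem _ _ hmem
  have hle := genSubalg_inf_centraliser_le_span hdim hdiv hpc hexc.1 hx hf0 hfmem
  refine ⟨?_, c • centralPart m h x, ⟨hfmem, hf0, hff⟩, ?_, ?_⟩
  · rw [le_antisymm hle ((Submodule.span_singleton_le_iff_mem _ _).2 hfmem),
      finrank_span_singleton hf0]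
  · exact exceptional_of_centralPart_eq_smul hdim hdiv hpc he hee hexc hh hx hf0 hff
      (inv_ne_zero hc) (by simp [smul_smul, hc])
  · rintro g ⟨hg, hg0, hgg⟩
    generalize c • centralPart m h x = f at *
    obtain ⟨s, rfl⟩ := Submodule.mem_span_singleton.1 (hle hg)
    have hs0 : s ≠ 0 := (smul_ne_zero_iff.1 hg0).1
    rw [LinearMap.map_smul₂, map_smul, hff, smul_smul] at hgg
    have := mul_left_cancel₀ hs0 ((smul_left_injective ℝ hf0 hgg).trans (mul_one s).symm)
    rw [this, one_smul]
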